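/- arXiv:2108.11181 — 2 statements merged into one kernel-verified Lean document; each statement's English description precedes it below -/
import Mathlib

section
/- There are exactly 448 even-intersecting subsets of V of cardinality 6; that is, |C₆| = 448. -/
/-- `V` is the 4-dimensional vector space over `𝔽₂`. -/
abbrev V : Type := Fin 4 → ZMod 2

/-- An affine hyperplane in `V`: a level set `{x | φ x = c}` of a nonzero linear
functional `φ` (equivalently, a coset of a 3-dimensional linear subspace). -/
def IsAffineHyperplane (H : Set V) : Prop :=
  ∃ (φ : V →ₗ[ZMod 2] ZMod 2) (c : ZMod 2), φ ≠ 0 ∧ H = {x | φ x = c}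

/-- `S ⊆ V` is even-intersecting if `|S ∩ ω|` is even for every affine hyperplane `ω`. -/
def EvenIntersecting (S : Set V) : Prop :=
  ∀ H : Set V, IsAffineHyperplane H → Even (S ∩ H).ncard

/-- The `k`-element subsets of a finite additive group whose elements sum to zero. -/
def zeroSumSubsets (G : Type*) [AddCommGroup G] [Fintype G] [DecidableEq G] (k : ℕ) :
    Finset (Finset G) :=
  {S ∈ Finset.univ.powersetCard k | ∑ x ∈ S, x = 0}

theorem sum_erase_eq_of_sum_eq_zero {G : Type*} [AddCommGroup G] [DecidableEq G]
    (h2 : ∀ x : G, x + x = 0) {S : Finset G} {x : G}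
    (hx : x ∈ S) (hS : ∑ y ∈ S, y = 0) : ∑ y ∈ S.erase x, y = x := by
  have h := Finset.add_sum_erase S (fun y => y) hx
  rw [hS] at h
  exact (neg_eq_of_add_eq_zero_right h).symm.trans (neg_eq_of_add_eq_zero_right (h2 x))

section Recurrence

variable {G : Type*} [AddCommGroup G] [Fintype G] [DecidableEq G]

theorem mem_zeroSumSubsets {k : ℕ} {S : Finset G} :
    S ∈ zeroSumSubsets G k ↔ S.card = k ∧ ∑ x ∈ S, x = 0 := by
  simp [zeroSumSubsets, Finset.mem_powersetCard]

theorem card_filter_sum_notMem (h2 : ∀ x : G, x + x = 0) (k : ℕ) :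
    ((Finset.univ.powersetCard (k + 1)).filter fun T : Finset G => ∑ x ∈ T, x ∉ T).card =
      (k + 2) * (zeroSumSubsets G (k + 2)).card := by
  have h : ((zeroSumSubsets G (k + 2)).sigma fun S => S).card =
      (k + 2) * (zeroSumSubsets G (k + 2)).card := by
    rw [Finset.card_sigma, Finset.sum_congr rfl fun S hS => (mem_zeroSumSubsets.1 hS).1,
      Finset.sum_const, smul_eq_mul, mul_comm]
  rw [← h]
  symm
  refine Finset.card_bij' (fun p _ => p.1.erase p.2)
    (fun T _ => ⟨insert (∑ x ∈ T, x) T, ∑ x ∈ T, x⟩) ?_ ?_ ?_ ?_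
  · rintro ⟨S, x⟩ hp
    obtain ⟨hS, hx⟩ := Finset.mem_sigma.1 hp
    obtain ⟨hc, hs⟩ := mem_zeroSumSubsets.1 hS
    have he := sum_erase_eq_of_sum_eq_zero h2 hx hs
    simp_all [Finset.mem_powersetCard, Finset.card_erase_of_mem]
  · intro T hT
    obtain ⟨hc, hn⟩ := Finset.mem_filter.1 hT
    have hc := (Finset.mem_powersetCard.1 hc).2
    simp [mem_zeroSumSubsets, Finset.card_insert_of_notMem hn, Finset.sum_insert hn, hc, h2]
  · rintro ⟨S, x⟩ hp
    obtain ⟨hS, hx⟩ := Finset.mem_sigma.1 hp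
    have he := sum_erase_eq_of_sum_eq_zero h2 hx (mem_zeroSumSubsets.1 hS).2
    simp only [he, Finset.insert_erase hx]
  · intro T hT
    exact Finset.erase_insert (Finset.mem_filter.1 hT).2

theorem card_filter_sum_mem (k : ℕ) :
    ((Finset.univ.powersetCard (k + 1)).filter fun T : Finset G => ∑ x ∈ T, x ∈ T).card =
      (Fintype.card G - k) * (zeroSumSubsets G k).card := by
  have h : ((zeroSumSubsets G k).sigma fun S => Sᶜ).card =
      (Fintype.card G - k) * (zeroSumSubsets G k).card := by
    rw [Finset.card_sigma, Finset.sum_congr rfl fun S hS => by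
      rw [Finset.card_compl, (mem_zeroSumSubsets.1 hS).1],
      Finset.sum_const, smul_eq_mul, mul_comm]
  rw [← h]
  symm
  refine Finset.card_bij' (fun p _ => insert p.2 p.1)
    (fun T _ => ⟨T.erase (∑ x ∈ T, x), ∑ x ∈ T, x⟩) ?_ ?_ ?_ ?_
  · rintro ⟨S, x⟩ hp
    obtain ⟨hS, hx⟩ := Finset.mem_sigma.1 hp
    obtain ⟨hc, hs⟩ := mem_zeroSumSubsets.1 hS
    have hx := Finset.mem_compl.1 hx
    simp_all [Finset.mem_powersetCard, Finset.sum_insert]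
  · intro T hT
    obtain ⟨hc, hn⟩ := Finset.mem_filter.1 hT
    have hc := (Finset.mem_powersetCard.1 hc).2
    have he := Finset.add_sum_erase T (fun y => y) hn
    simp_all [mem_zeroSumSubsets, Finset.card_erase_of_mem]
  · rintro ⟨S, x⟩ hp
    obtain ⟨hS, hx⟩ := Finset.mem_sigma.1 hp
    have hx := Finset.mem_compl.1 hx
    have he : ∑ y ∈ insert x S, y = x := by
      rw [Finset.sum_insert hx, (mem_zeroSumSubsets.1 hS).2, add_zero]
    simp only [he, Finset.erase_insert hx]
  · intro T hT
    exact Finset.insert_erase (Finset.mem_filter.1 hT).2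

/-- Each `(k + 1)`-subset `T` either contains its own sum, and then arises from a zero-sum
`k`-subset by adding a point, or does not, and then arises from a zero-sum `(k + 2)`-subset by
removing a point. -/
theorem card_zeroSumSubsets_recurrence (h2 : ∀ x : G, x + x = 0) (k : ℕ) :
    (Fintype.card G - k) * (zeroSumSubsets G k).card +
      (k + 2) * (zeroSumSubsets G (k + 2)).card = (Fintype.card G).choose (k + 1) := by
  rw [← card_filter_sum_mem, ← card_filter_sum_notMem h2,
    Finset.card_filter_add_card_filter_not, Finset.card_powersetCard, Finset.card_univ]

end Recurrence

theorem card_zeroSumSubsets_zero (G : Type*) [AddCommGroup G] [Fintype G] [DecidableEq G] :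
    (zeroSumSubsets G 0).card = 1 := by
  simp [zeroSumSubsets, Finset.filter_singleton]

theorem card_zeroSumSubsets_six : (zeroSumSubsets V 6).card = 448 := by
  have h2 : ∀ x : V, x + x = 0 := CharTwo.add_self_eq_zero
  have hV : Fintype.card V = 16 := by simp [ZMod.card]
  have r0 := card_zeroSumSubsets_recurrence h2 0
  have r2 := card_zeroSumSubsets_recurrence h2 2
  have r4 := card_zeroSumSubsets_recurrence h2 4
  rw [card_zeroSumSubsets_zero] at r0
  norm_num [hV, Nat.choose] at r0 r2 r4
  simp only [r0, Finset.card_empty] at r2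
  omega

theorem sum_zmod_two_eq_card {α : Type*} (S : Finset α) (f : α → ZMod 2) :
    ∑ x ∈ S, f x = ((S.filter fun x => f x = 1).card : ZMod 2) := by
  rw [Finset.card_filter, Nat.cast_sum]
  refine Finset.sum_congr rfl fun x _ => ?_
  generalize f x = a
  revert a
  decide

theorem ncard_coe_inter_level (S : Finset V) (φ : V →ₗ[ZMod 2] ZMod 2) (c : ZMod 2) :
    ((S : Set V) ∩ {x | φ x = c}).ncard = (S.filter fun x => φ x = c).card := by
  rw [← Set.ncard_coe_finset]
  congr 1
  ext x
  simp

theorem evenIntersecting_coe_iff {S : Finset V} (hS : Even S.card) :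
    EvenIntersecting (S : Set V) ↔ ∑ x ∈ S, x = 0 := by
  have key (φ : V →ₗ[ZMod 2] ZMod 2) :
      Even (S.filter fun x => φ x = 1).card ↔ φ (∑ x ∈ S, x) = 0 := by
    rw [map_sum, sum_zmod_two_eq_card, ZMod.natCast_eq_zero_iff_even]
  constructor
  · intro h
    rw [← Module.forall_dual_apply_eq_zero_iff (ZMod 2)]
    intro φ
    by_cases hφ : φ = 0
    · simp [hφ]
    · rw [← key, ← ncard_coe_inter_level]
      exact h _ ⟨φ, 1, hφ, rfl⟩
  · rintro h _ ⟨φ, c, -, rfl⟩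
    rw [ncard_coe_inter_level]
    have h1 : Even (S.filter fun x => φ x = 1).card := by rw [key, h, map_zero]
    have hc : c = 1 ∨ c = 0 := by revert c; decide
    obtain rfl | rfl := hc
    · exact h1
    · have h0 : (S.filter fun x => φ x = 0) = S.filter fun x => ¬ φ x = 1 :=
        Finset.filter_congr fun x _ => by
          generalize φ x = a
          revert a
          decide
      have hadd := Finset.card_filter_add_card_filter_not (s := S) fun x => φ x = 1
      rw [← hadd, Nat.even_add] at hS
      rw [h0]
      exact hS.1 h1

/-- `|C₆| = 448`. -/
theorem evenIntersecting_card_six :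
    {S : Set V | EvenIntersecting S ∧ S.ncard = 6}.ncard = 448 := by
  have h : {S : Set V | EvenIntersecting S ∧ S.ncard = 6} =
      (fun S : Finset V => (S : Set V)) '' (zeroSumSubsets V 6 : Set (Finset V)) := by
    ext S
    obtain ⟨S, rfl⟩ := S.toFinite.exists_finset_coe
    simp only [Set.mem_ofPred_eq, Set.ncard_coe_finset, Set.mem_image, Finset.coe_inj,
      exists_eq_right, Finset.mem_coe, mem_zeroSumSubsets]
    rw [and_comm]
    refine and_congr_right fun hc => evenIntersecting_coe_iff ?_
    rw [hc]
    decide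
  rw [h, Set.ncard_image_of_injective _ Finset.coe_injective, Set.ncard_coe_finset,
    card_zeroSumSubsets_six]
end

section
/- There are exactly 870 even-intersecting subsets of V of cardinality 8; that is, |C₈| = 870. Moreover, every affine hyperplane of V belongs to C₈. -/
theorem natCast_card_filter_eq (φ : V →ₗ[ZMod 2] ZMod 2) (c : ZMod 2) (s : Finset V) :
    ((s.filter (fun x => φ x = c)).card : ZMod 2) = φ (∑ x ∈ s, x) + s.card * (c + 1) := by
  have h : ∀ a c : ZMod 2, (if a = c then (1 : ZMod 2) else 0) = a + (c + 1) := by decide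
  simp [← Finset.sum_boole, h, Finset.sum_add_distrib, map_sum, mul_add]

theorem coe_inter_level_ncard (φ : V →ₗ[ZMod 2] ZMod 2) (c : ZMod 2) (s : Finset V) :
    ((s : Set V) ∩ {x | φ x = c}).ncard = (s.filter (fun x => φ x = c)).card := by
  rw [← Set.ncard_coe_finset]
  congr 1
  ext x
  simp

/-- A set of even cardinality is even-intersecting exactly when its elements sum to zero. -/
theorem evenIntersecting_coe_iff_sum_eq_zero {s : Finset V} (hs : Even s.card) :
    EvenIntersecting (s : Set V) ↔ ∑ x ∈ s, x = 0 := by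
  have hs' : (s.card : ZMod 2) = 0 := (ZMod.natCast_eq_zero_iff_even).2 hs
  constructor
  · intro h
    ext i
    have hi : (LinearMap.proj i : V →ₗ[ZMod 2] ZMod 2) ≠ 0 := fun h0 => by
      simpa using LinearMap.congr_fun h0 (fun _ => 1)
    have := h _ ⟨LinearMap.proj i, 1, hi, rfl⟩
    rw [coe_inter_level_ncard, ← ZMod.natCast_eq_zero_iff_even, natCast_card_filter_eq, hs'] at this
    simpa using this
  · rintro h _ ⟨φ, c, -, rfl⟩
    rw [coe_inter_level_ncard, ← ZMod.natCast_eq_zero_iff_even, natCast_card_filter_eq, hs', h]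
    simp

/-- The nontrivial character of `ZMod 2` with values in `ℤ`. -/
def zmodTwoSign (a : ZMod 2) : ℤ := if a = 0 then 1 else -1

theorem zmodTwoSign_sum (y : V) (s : Finset V) :
    zmodTwoSign (y ⬝ᵥ ∑ x ∈ s, x) = ∏ x ∈ s, zmodTwoSign (y ⬝ᵥ x) := by
  have hadd : ∀ a b, zmodTwoSign (a + b) = zmodTwoSign a * zmodTwoSign b := by decide
  induction s using Finset.induction_on with
  | empty => simp [zmodTwoSign]
  | insert a s ha ih => rw [Finset.sum_insert ha, Finset.prod_insert ha, dotProduct_add, hadd, ih]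

theorem sum_zmodTwoSign (x : V) :
    ∑ y : V, zmodTwoSign (y ⬝ᵥ x) = if x = 0 then 16 else 0 := by
  revert x
  decide +kernel

theorem esymm_eight_signs :
    (Multiset.replicate 8 (1 : ℤ) + Multiset.replicate 8 (-1)).esymm 8 = 70 := by
  have h := Multiset.prod_X_add_C_coeff
    (Multiset.replicate 8 (1 : ℤ) + Multiset.replicate 8 (-1)) (k := 8) (by simp)
  simp only [Multiset.card_add, Multiset.card_replicate, Nat.reduceAdd, Nat.reduceSub] at h
  rw [← h]
  have hp : ((Multiset.replicate 8 (1 : ℤ) + Multiset.replicate 8 (-1)).map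
      (fun r => Polynomial.X + Polynomial.C r)).prod =
      Polynomial.expand ℤ 2 ((Polynomial.X + Polynomial.C (-1)) ^ 8) := by
    simp only [Multiset.map_add, Multiset.map_replicate, Multiset.prod_add,
      Multiset.prod_replicate, ← mul_pow, map_pow, map_add, Polynomial.expand_X,
      Polynomial.expand_C]
    congr 1
    simp only [map_neg, map_one]
    ring
  rw [hp, show 8 = 4 * 2 from rfl, Polynomial.coeff_expand_mul (by norm_num),
    Polynomial.coeff_X_add_C_pow]
  decide

theorem sum_powersetCard_eight_prod_zmodTwoSign (y : V) :
    ∑ s ∈ (Finset.univ : Finset V).powersetCard 8, ∏ x ∈ s, zmodTwoSign (y ⬝ᵥ x) =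
      if y = 0 then 12870 else 70 := by
  split_ifs with hy
  · have hc : Fintype.card V = 16 := by simp
    simp only [hy, zero_dotProduct, zmodTwoSign, if_true, Finset.prod_const_one, Finset.sum_const,
      Finset.card_powersetCard, Finset.card_univ, hc]
    decide
  · have hm : ∀ y : V, y ≠ 0 → (Finset.univ : Finset V).val.map (fun x => zmodTwoSign (y ⬝ᵥ x)) =
        Multiset.replicate 8 1 + Multiset.replicate 8 (-1) := by decide +kernel
    rw [← Finset.esymm_map_val, hm y hy, esymm_eight_signs]

theorem card_powersetCard_eight_sum_eq_zero :
    (((Finset.univ : Finset V).powersetCard 8).filter (fun s => ∑ x ∈ s, x = 0)).card = 870 := by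
  have h : ∑ s ∈ (Finset.univ : Finset V).powersetCard 8,
      ∑ y : V, zmodTwoSign (y ⬝ᵥ ∑ x ∈ s, x) = 13920 := by
    rw [Finset.sum_comm]
    simp only [zmodTwoSign_sum, sum_powersetCard_eight_prod_zmodTwoSign]
    decide +kernel
  simp only [sum_zmodTwoSign] at h
  rw [← Finset.sum_filter, Finset.sum_const, nsmul_eq_mul] at h
  lia

theorem affineHyperplane_card_and_sum : ∀ (y : V) (c : ZMod 2), y ≠ 0 →
    (Finset.univ.filter (fun x : V => y ⬝ᵥ x = c)).card = 8 ∧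
      ∑ x : V with y ⬝ᵥ x = c, x = 0 := by
  decide +kernel

theorem exists_dotProduct_eq {φ : V →ₗ[ZMod 2] ZMod 2} (hφ : φ ≠ 0) :
    ∃ y : V, y ≠ 0 ∧ ∀ x, φ x = y ⬝ᵥ x := by
  have h : ∀ x, φ x = (fun i => φ (fun j => if i = j then 1 else 0)) ⬝ᵥ x := fun x => by
    rw [LinearMap.pi_apply_eq_sum_univ φ x]
    simp [dotProduct, mul_comm]
  refine ⟨_, fun h0 => hφ (LinearMap.ext fun x => ?_), h⟩
  rw [h x, h0, zero_dotProduct, LinearMap.zero_apply]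

/-- `|C₈| = 870`, and every affine hyperplane belongs to `C₈`. -/
theorem evenIntersecting_card_eight :
    {S : Set V | EvenIntersecting S ∧ S.ncard = 8}.ncard = 870 ∧
    ∀ H : Set V, IsAffineHyperplane H → EvenIntersecting H ∧ H.ncard = 8 := by
  constructor
  · rw [← card_powersetCard_eight_sum_eq_zero, ← Set.ncard_coe_finset,
      ← Set.ncard_image_of_injective _ (Finset.coe_injective (α := V))]
    congr 1
    ext S
    obtain ⟨s, rfl⟩ := S.toFinite.exists_finset_coe
    simp only [Set.mem_ofPred_eq, Set.ncard_coe_finset, Set.mem_image, Finset.mem_coe,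
      Finset.mem_filter, Finset.mem_powersetCard_univ, Finset.coe_inj, exists_eq_right]
    rw [and_comm]
    exact and_congr_right fun hs => evenIntersecting_coe_iff_sum_eq_zero (hs ▸ by decide)
  · rintro _ ⟨φ, c, hφ, rfl⟩
    obtain ⟨y, hy, h⟩ := exists_dotProduct_eq hφ
    obtain ⟨hcard, hsum⟩ := affineHyperplane_card_and_sum y c hy
    have hH : {x | φ x = c} =
        ((Finset.univ.filter (fun x : V => y ⬝ᵥ x = c) : Finset V) : Set V) := by
      ext x
      simp [h]
    rw [hH, Set.ncard_coe_finset]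
    exact ⟨(evenIntersecting_coe_iff_sum_eq_zero (hcard ▸ by decide)).2 hsum, hcard⟩
end
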